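/- arXiv:0809.0415 — 2 statements merged into one kernel-verified Lean document; each statement's English description precedes it below -/
import Mathlib

section
/- Let G be a group and A a commutative ring. The map sending a 2-dimensional A-valued determinant D on G to the pair of functions (T, D|_G), where T(g) = Λ₁(g) is the trace and D|_G(g) is the value of the determinant at g, is a bijection between the set of A-valued determinants of dimension 2 on G and the set of pairs (T, D) of functions G → A such that: D : G → A^* is a group homomorphism, T(1) = 2, and for all g, h ∈ G one has (a) T(gh) = T(hg) and (b) D(g)T(g⁻¹h) − T(g)T(h) + T(gh) = 0. -/
open TensorProduct

/-- An `A`-polynomial law between the `A`-modules `M` and `N` : a family of maps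
`B ⊗[A] M → B ⊗[A] N` indexed by the commutative `A`-algebras `B`, natural in `B`. -/
structure PolyLaw (A : Type) [CommRing A] (M : Type) [AddCommGroup M] [Module A M]
    (N : Type) [AddCommGroup N] [Module A N] where
  toFun : ∀ (B : Type) [CommRing B] [Algebra A B], B ⊗[A] M → B ⊗[A] N
  isCompat : ∀ (B : Type) [CommRing B] [Algebra A B] (C : Type) [CommRing C] [Algebra A C]
      (φ : B →ₐ[A] C) (x : B ⊗[A] M),
      toFun C (LinearMap.rTensor M φ.toLinearMap x) = LinearMap.rTensor N φ.toLinearMap (toFun B x)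

namespace PolyLaw

variable {A : Type} [CommRing A]

/-- `P` is homogeneous of degree `d` if `P (b • x) = b ^ d • P x` over every base change. -/
def IsHomogeneous {M N : Type} [AddCommGroup M] [Module A M] [AddCommGroup N] [Module A N]
    (P : PolyLaw A M N) (d : ℕ) : Prop :=
  ∀ (B : Type) [CommRing B] [Algebra A B] (b : B) (x : B ⊗[A] M),
    P.toFun B (b • x) = b ^ d • P.toFun B x

/-- A polynomial law between `A`-algebras is multiplicative if it sends `1` to `1` and
products to products, over every base change. -/
def IsMultiplicative {R S : Type} [Ring R] [Algebra A R] [Ring S] [Algebra A S]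
    (P : PolyLaw A R S) : Prop :=
  (∀ (B : Type) [CommRing B] [Algebra A B], P.toFun B 1 = 1) ∧
  ∀ (B : Type) [CommRing B] [Algebra A B] (x y : B ⊗[A] R),
    P.toFun B (x * y) = P.toFun B x * P.toFun B y

/-- The kernel of a polynomial law. -/
def ker {M N : Type} [AddCommGroup M] [Module A M] [AddCommGroup N] [Module A N]
    (P : PolyLaw A M N) : Set M :=
  {x | ∀ (B : Type) [CommRing B] [Algebra A B] (b : B) (m : B ⊗[A] M),
    P.toFun B (b ⊗ₜ[A] x + m) = P.toFun B m}

/-- Evaluation of a polynomial law at an element of `M` (over the base `A` itself). -/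
noncomputable def ground {M N : Type} [AddCommGroup M] [Module A M] [AddCommGroup N] [Module A N]
    (P : PolyLaw A M N) (m : M) : N :=
  TensorProduct.lid A N (P.toFun A ((1 : A) ⊗ₜ[A] m))

end PolyLaw

variable {G A : Type} [Group G] [CommRing A]

/-- The trace `T(g) = Λ₁(g)` of a `2`-dimensional determinant on a group `G` : if
`D(t - g) = t² - T(g) t + D(g)` then `T(g)` is minus the coefficient of `t` in `D(t - g)`. -/
noncomputable def traceFn (D : PolyLaw ℤ (MonoidAlgebra ℤ G) A) (g : G) : A :=
  - TensorProduct.lid ℤ A (LinearMap.rTensor A (Polynomial.lcoeff ℤ 1)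
      (D.toFun (Polynomial ℤ)
        ((Polynomial.X : Polynomial ℤ) ⊗ₜ[ℤ] (1 : MonoidAlgebra ℤ G)
          - (1 : Polynomial ℤ) ⊗ₜ[ℤ] (MonoidAlgebra.of ℤ G g))))

/-- The value `D(g)` of the determinant at a group element `g`. -/
noncomputable def detFn (D : PolyLaw ℤ (MonoidAlgebra ℤ G) A) (g : G) : A :=
  D.ground (MonoidAlgebra.of ℤ G g)

/-- The conditions on a pair of functions `(T, D) : G → A` : `D : G → Aˣ` is a group
homomorphism, `T 1 = 2`, `T(gh) = T(hg)` and `D(g) T(g⁻¹h) - T(g) T(h) + T(gh) = 0`. -/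
def PairCond (T D : G → A) : Prop :=
  (∀ g, IsUnit (D g)) ∧ D 1 = 1 ∧ (∀ g h, D (g * h) = D g * D h) ∧
  T 1 = 2 ∧ (∀ g h, T (g * h) = T (h * g)) ∧
  (∀ g h, D g * T (g⁻¹ * h) - T g * T h + T (g * h) = 0)

/-- Two quadratic maps are equal if they and their polar forms agree on a spanning family. -/
theorem QuadraticMap.ext_of_span {ι R M N : Type*} [CommRing R] [AddCommGroup M] [Module R M]
    [AddCommGroup N] [Module R N] {v : ι → M} (hv : Submodule.span R (Set.range v) = ⊤)
    {Q Q' : QuadraticMap R M N} (h : ∀ i, Q (v i) = Q' (v i))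
    (hp : ∀ i j, QuadraticMap.polar Q (v i) (v j) = QuadraticMap.polar Q' (v i) (v j)) :
    Q = Q' := by
  have hpolar : Q.polarBilin = Q'.polarBilin := by
    refine LinearMap.ext_on_range hv fun i => LinearMap.ext_on_range hv fun j => ?_
    simpa using hp i j
  ext x
  have hx : x ∈ Submodule.span R (Set.range v) := hv ▸ Submodule.mem_top
  induction hx using Submodule.span_induction with
  | mem x hx => obtain ⟨i, rfl⟩ := hx; exact h i
  | zero => simp
  | add x y _ _ hx hy =>
    have hxy := LinearMap.congr_fun₂ hpolar x y
    simp only [QuadraticMap.polarBilin_apply_apply] at hxy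
    rw [QuadraticMap.map_add Q, QuadraticMap.map_add Q', hx, hy, hxy]
  | smul a x _ hx => rw [QuadraticMap.map_smul, QuadraticMap.map_smul, hx]

namespace PolyLaw

section Quadratic

variable {R M N : Type} [CommRing R] [AddCommGroup M] [Module R M] [AddCommGroup N] [Module R N]

@[ext]
theorem ext {P P' : PolyLaw R M N}
    (h : ∀ (B : Type) [CommRing B] [Algebra R B] (x : B ⊗[R] M), P.toFun B x = P'.toFun B x) :
    P = P' := by
  cases P
  cases P'
  congr
  funext B _ _ x
  exact h B x

open MvPolynomial in
/-- The homogeneous components of a polynomial are read off by scaling its variables. -/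
theorem coeff_aeval_X_mul_C {σ B : Type*} [CommRing B] (d : ℕ) (p : MvPolynomial σ B) :
    (aeval (fun i => (Polynomial.X : Polynomial (MvPolynomial σ B)) * Polynomial.C (X i)) p).coeff d
      = homogeneousComponent d p := by
  induction p using MvPolynomial.induction_on' with
  | monomial m c =>
    have hm : aeval (fun i => (Polynomial.X : Polynomial (MvPolynomial σ B)) * Polynomial.C (X i))
        (monomial m c) = Polynomial.C (monomial m c) * Polynomial.X ^ m.degree := by
      rw [aeval_monomial, monomial_eq (s := m), Finsupp.degree_apply]
      simp only [Finsupp.prod, mul_pow, Finset.prod_mul_distrib, Finset.prod_pow_eq_pow_sum,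
        map_mul, map_prod, map_pow]
      rw [Polynomial.algebraMap_apply]
      simp only [MvPolynomial.algebraMap_eq]
      ring
    rw [hm, Polynomial.coeff_C_mul_X_pow]
    split_ifs with h
    · rw [homogeneousComponent_of_mem (isHomogeneous_monomial c rfl), if_pos h]
    · rw [homogeneousComponent_of_mem (isHomogeneous_monomial c rfl), if_neg h]
  | add p q hp hq => simp only [map_add, Polynomial.coeff_add, hp, hq]

variable (P : PolyLaw R M N) {d : ℕ}

variable (R) in
/-- The generic linear combination `∑ i, X i • x i`. -/
noncomputable def genericSum {σ B : Type} [Fintype σ] [CommRing B] [Algebra R B]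
    (x : σ → B ⊗[R] M) : MvPolynomial σ B ⊗[R] M :=
  ∑ i, (MvPolynomial.X i : MvPolynomial σ B) •
    LinearMap.rTensor M (IsScalarTower.toAlgHom R B (MvPolynomial σ B)).toLinearMap (x i)

theorem rTensor_smul {B C : Type} [CommRing B] [Algebra R B] [CommRing C] [Algebra R C]
    (φ : B →ₐ[R] C) (b : B) (x : B ⊗[R] M) :
    LinearMap.rTensor M φ.toLinearMap (b • x) = φ b • LinearMap.rTensor M φ.toLinearMap x := by
  induction x using TensorProduct.induction_on with
  | zero => simp
  | tmul c m => simp [TensorProduct.smul_tmul']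
  | add x y hx hy => simp only [smul_add, map_add, hx, hy]

theorem rTensor_genericSum {σ B C : Type} [Fintype σ] [CommRing B] [Algebra R B]
    [CommRing C] [Algebra R C] (φ : MvPolynomial σ B →ₐ[R] C) (x : σ → B ⊗[R] M) :
    LinearMap.rTensor M φ.toLinearMap (genericSum R x) = ∑ i, φ (MvPolynomial.X i) •
      LinearMap.rTensor M (φ.comp (IsScalarTower.toAlgHom R B _)).toLinearMap (x i) := by
  simp only [genericSum, map_sum, rTensor_smul, AlgHom.comp_toLinearMap, LinearMap.rTensor_comp,
    LinearMap.comp_apply]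

variable {P}

theorem IsHomogeneous.rTensor_homogeneousComponent (hP : P.IsHomogeneous d) {σ B : Type}
    [Fintype σ] [CommRing B] [Algebra R B] (x : σ → B ⊗[R] M) :
    LinearMap.rTensor N ((MvPolynomial.homogeneousComponent d).restrictScalars R)
      (P.toFun (MvPolynomial σ B) (genericSum R x)) =
      P.toFun (MvPolynomial σ B) (genericSum R x) := by
  set S := MvPolynomial σ B
  let φ : S →ₐ[R] Polynomial S := (MvPolynomial.aeval
    (fun i => (Polynomial.X : Polynomial S) * Polynomial.C (MvPolynomial.X i))).restrictScalars R
  let ψ : S →ₐ[R] Polynomial S := IsScalarTower.toAlgHom R S (Polynomial S)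
  have hψ (p : S) : ψ p = Polynomial.C p := rfl
  let c : Polynomial S →ₗ[R] S := (Polynomial.lcoeff S d).restrictScalars R
  have h : LinearMap.rTensor M φ.toLinearMap (genericSum R x) =
      (Polynomial.X : Polynomial S) • LinearMap.rTensor M ψ.toLinearMap (genericSum R x) := by
    rw [rTensor_genericSum, rTensor_genericSum, Finset.smul_sum]
    refine Finset.sum_congr rfl fun i _ => ?_
    rw [smul_smul]
    congr 1
    · exact MvPolynomial.aeval_X _ i
    · congr 2
      exact LinearMap.ext fun b => MvPolynomial.aeval_C _ b
  have h1 : c ∘ₗ φ.toLinearMap = (MvPolynomial.homogeneousComponent d).restrictScalars R :=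
    LinearMap.ext fun p => coeff_aeval_X_mul_C d p
  have h2 : c ∘ₗ (LinearMap.mulLeft R (Polynomial.X ^ d)) ∘ₗ ψ.toLinearMap = LinearMap.id := by
    refine LinearMap.ext fun p => ?_
    simp [c, hψ]
  have h3 := P.isCompat _ _ φ (genericSum R x)
  rw [h, hP, P.isCompat] at h3
  have h4 (y : Polynomial S ⊗[R] N) : (Polynomial.X : Polynomial S) ^ d • y =
      LinearMap.rTensor N (LinearMap.mulLeft R (Polynomial.X ^ d)) y := by
    induction y using TensorProduct.induction_on with
    | zero => simp
    | tmul c m => simp [TensorProduct.smul_tmul']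
    | add x y hx hy => simp only [smul_add, map_add, hx, hy]
  rw [← h1, LinearMap.rTensor_comp, LinearMap.comp_apply, ← h3, h4, ← LinearMap.comp_apply,
    ← LinearMap.comp_apply, ← LinearMap.rTensor_comp, ← LinearMap.rTensor_comp, LinearMap.comp_assoc,
    h2, LinearMap.rTensor_id, LinearMap.id_apply]

theorem rTensor_eval_genericSum {σ B : Type} [Fintype σ] [CommRing B] [Algebra R B]
    (x : σ → B ⊗[R] M) (a : σ → B) :
    LinearMap.rTensor N (((MvPolynomial.aeval a).restrictScalars R :
        MvPolynomial σ B →ₐ[R] B)).toLinearMap (P.toFun _ (genericSum R x)) =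
      P.toFun B (∑ i, a i • x i) := by
  rw [← P.isCompat, rTensor_genericSum]
  congr 1
  refine Finset.sum_congr rfl fun i _ => ?_
  have : ((MvPolynomial.aeval a).restrictScalars R : MvPolynomial σ B →ₐ[R] B).comp
      (IsScalarTower.toAlgHom R B _) = AlgHom.id R B := by
    ext b
    simp
  rw [this]
  simp

/-- A linear relation between values of degree `d` forms holds between values of homogeneous
polynomial laws of degree `d`. -/
theorem IsHomogeneous.sum_smul_eq_zero (hP : P.IsHomogeneous d) {σ ι B : Type} [Fintype σ]
    [Fintype ι] [CommRing B] [Algebra R B] (c : ι → B) (a : ι → σ → B)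
    (h : ∀ m : σ →₀ ℕ, m.degree = d → ∑ j, c j * m.prod (fun i k => a j i ^ k) = 0)
    (x : σ → B ⊗[R] M) :
    ∑ j, c j • P.toFun B (∑ i, a j i • x i) = 0 := by
  let l : MvPolynomial σ B →ₗ[B] B :=
    ∑ j, c j • (MvPolynomial.aeval (a j) : MvPolynomial σ B →ₐ[B] B).toLinearMap
  have hl : l ∘ₗ MvPolynomial.homogeneousComponent d = 0 := by
    refine (MvPolynomial.basisMonomials σ B).ext fun m => ?_
    by_cases hm : m.degree = d
    · simpa [l, MvPolynomial.homogeneousComponent_of_mem (MvPolynomial.isHomogeneous_monomial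
        (1 : B) rfl), hm, MvPolynomial.aeval_monomial, -MvPolynomial.aeval_eq_eval] using h m hm
    · simp [MvPolynomial.homogeneousComponent_of_mem (MvPolynomial.isHomogeneous_monomial
        (1 : B) rfl), Ne.symm hm]
  have hsmul (b : B) (f : MvPolynomial σ B →ₗ[R] B) (y : MvPolynomial σ B ⊗[R] N) :
      b • LinearMap.rTensor N f y = LinearMap.rTensor N (b • f) y := by
    induction y using TensorProduct.induction_on with
    | zero => simp
    | tmul c m => simp [TensorProduct.smul_tmul']
    | add x y hx hy => simp only [smul_add, map_add, hx, hy]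
  have key : LinearMap.rTensor N (l.restrictScalars R) (P.toFun _ (genericSum R x)) =
      ∑ j, c j • P.toFun B (∑ i, a j i • x i) := by
    simp_rw [← rTensor_eval_genericSum, hsmul]
    rw [← LinearMap.sum_apply, ← LinearMap.coe_rTensorHom, ← map_sum]
    congr 2
    ext p
    simp [l]
  rw [← key, ← hP.rTensor_homogeneousComponent, ← LinearMap.comp_apply, ← LinearMap.rTensor_comp,
    ← LinearMap.restrictScalars_comp, hl]
  simp

theorem IsHomogeneous.polar_add_left (hP : P.IsHomogeneous 2) {B : Type} [CommRing B] [Algebra R B]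
    (x y z : B ⊗[R] M) : QuadraticMap.polar (P.toFun B) (x + y) z =
      QuadraticMap.polar (P.toFun B) x z + QuadraticMap.polar (P.toFun B) y z := by
  have hneg (b : B) (u : B ⊗[R] N) : -b • u = -(b • u) := neg_smul b u
  have h := hP.sum_smul_eq_zero (σ := Fin 3) (ι := Fin 7) (B := B) ![1, -1, -1, -1, 1, 1, 1]
    ![![1, 1, 1], ![1, 1, 0], ![1, 0, 1], ![0, 1, 1], ![1, 0, 0], ![0, 1, 0], ![0, 0, 1]]
    (fun m hm => ?_) ![x, y, z]
  · simp only [Fin.sum_univ_succ, Fin.sum_univ_zero] at h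
    simp at h
    simp only [hneg, one_smul] at h
    simp only [QuadraticMap.polar]
    rw [← sub_eq_zero, ← h, add_assoc x y z]
    abel
  · rw [Finsupp.degree_eq_sum, Fin.sum_univ_three] at hm
    simp only [Finsupp.prod_fintype _ _ fun _ => pow_zero _, Fin.prod_univ_three]
    simp only [Fin.sum_univ_succ, Fin.sum_univ_zero]
    generalize m 0 = i at *
    generalize m 1 = j at *
    generalize m 2 = k at *
    obtain rfl : k = 2 - i - j := by omega
    have hi : i ≤ 2 := by omega
    have hj : j ≤ 2 := by omega
    interval_cases i <;> interval_cases j <;> simp_all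

theorem IsHomogeneous.polar_smul_left (hP : P.IsHomogeneous 2) {B : Type} [CommRing B]
    [Algebra R B] (b : B) (x y : B ⊗[R] M) : QuadraticMap.polar (P.toFun B) (b • x) y =
      b • QuadraticMap.polar (P.toFun B) x y := by
  have hneg (b : B) (u : B ⊗[R] N) : -b • u = -(b • u) := neg_smul b u
  have h := hP.sum_smul_eq_zero (σ := Fin 2) (ι := Fin 6) (B := B) ![1, -1, -1, -b, b, b]
    ![![b, 1], ![b, 0], ![0, 1], ![1, 1], ![1, 0], ![0, 1]]
    (fun m hm => ?_) ![x, y]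
  · simp only [Fin.sum_univ_succ, Fin.sum_univ_zero] at h
    simp at h
    simp only [hneg, one_smul] at h
    simp only [QuadraticMap.polar, smul_sub]
    rw [← sub_eq_zero, ← h]
    abel
  · rw [Finsupp.degree_eq_sum, Fin.sum_univ_two] at hm
    simp only [Finsupp.prod_fintype _ _ fun _ => pow_zero _, Fin.prod_univ_two]
    simp only [Fin.sum_univ_succ, Fin.sum_univ_zero]
    generalize m 0 = i at *
    generalize m 1 = j at *
    obtain rfl : j = 2 - i := by omega
    have hi : i ≤ 2 := by omega
    interval_cases i <;> simp_all

/-- The quadratic map over `B` given by a polynomial law which is homogeneous of degree `2`. -/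
def IsHomogeneous.quadraticMap (hP : P.IsHomogeneous 2) (B : Type) [CommRing B] [Algebra R B] :
    QuadraticMap B (B ⊗[R] M) (B ⊗[R] N) :=
  QuadraticMap.ofPolar (P.toFun B) (fun b x => by rw [hP, sq]) hP.polar_add_left
    hP.polar_smul_left

@[simp]
theorem IsHomogeneous.quadraticMap_apply (hP : P.IsHomogeneous 2) (B : Type) [CommRing B]
    [Algebra R B] (x : B ⊗[R] M) : hP.quadraticMap B x = P.toFun B x :=
  rfl

theorem IsHomogeneous.polar_quadraticMap (hP : P.IsHomogeneous 2) (B : Type) [CommRing B]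
    [Algebra R B] : QuadraticMap.polar (hP.quadraticMap B) = QuadraticMap.polar (P.toFun B) :=
  rfl

variable (P) in
theorem toFun_one_tmul (B : Type) [CommRing B] [Algebra R B] (x : M) :
    P.toFun B (1 ⊗ₜ x) = 1 ⊗ₜ P.ground x := by
  have h := P.isCompat R B (Algebra.ofId R B) (1 ⊗ₜ x)
  have h' (y : R ⊗[R] N) : LinearMap.rTensor N (Algebra.ofId R B).toLinearMap y =
      1 ⊗ₜ TensorProduct.lid R N y := by
    induction y using TensorProduct.induction_on with
    | zero => simp
    | tmul r n =>
      simp [Algebra.ofId_apply, Algebra.algebraMap_eq_smul_one, TensorProduct.smul_tmul]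
    | add y z hy hz => rw [map_add, hy, hz, map_add, TensorProduct.tmul_add]
  rw [h'] at h
  simpa [ground] using h

variable (P) in
theorem polar_toFun_one_tmul (B : Type) [CommRing B] [Algebra R B] (x y : M) :
    QuadraticMap.polar (P.toFun B) (1 ⊗ₜ x) (1 ⊗ₜ y) = 1 ⊗ₜ QuadraticMap.polar P.ground x y := by
  simp only [QuadraticMap.polar, ← TensorProduct.tmul_add, toFun_one_tmul, TensorProduct.tmul_sub]

/-- The quadratic map over the base ring given by a polynomial law which is homogeneous of
degree `2`. -/
noncomputable def IsHomogeneous.groundQuadraticMap (hP : P.IsHomogeneous 2) :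
    QuadraticMap R M N :=
  (TensorProduct.lid R N).toLinearMap.compQuadraticMap
    ((hP.quadraticMap R).comp (TensorProduct.mk R R M 1))

@[simp]
theorem IsHomogeneous.groundQuadraticMap_apply (hP : P.IsHomogeneous 2) (x : M) :
    hP.groundQuadraticMap x = P.ground x :=
  rfl

theorem span_one_tmul {ι : Type*} {v : ι → M} (hv : Submodule.span R (Set.range v) = ⊤)
    (B : Type) [CommRing B] [Algebra R B] :
    Submodule.span B (Set.range fun i => (1 : B) ⊗ₜ[R] v i) = ⊤ := by
  have := Submodule.baseChange_span (R := R) (A := B) (Set.range v)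
  rw [hv, Submodule.baseChange_top, ← Set.range_comp] at this
  exact this.symm

/-- Quadratic polynomial laws are determined by their values and polar forms on a spanning
family. -/
theorem IsHomogeneous.ext_of_span {ι : Type*} {v : ι → M}
    (hv : Submodule.span R (Set.range v) = ⊤) {P P' : PolyLaw R M N} (hP : P.IsHomogeneous 2)
    (hP' : P'.IsHomogeneous 2) (h : ∀ i, P.ground (v i) = P'.ground (v i))
    (hp : ∀ i j, QuadraticMap.polar P.ground (v i) (v j) =
      QuadraticMap.polar P'.ground (v i) (v j)) : P = P' := by
  ext B _ _ x
  refine DFunLike.congr_fun (F := QuadraticMap B (B ⊗[R] M) (B ⊗[R] N))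
    (f := hP.quadraticMap B) (g := hP'.quadraticMap B) ?_ x
  refine QuadraticMap.ext_of_span (span_one_tmul hv B) (fun i => ?_) fun i j => ?_
  · simp only [quadraticMap_apply, toFun_one_tmul, h]
  · simp only [polar_quadraticMap, polar_toFun_one_tmul, hp]

theorem rTensor_baseChange_bilinMap (β : LinearMap.BilinMap R M N) {B C : Type} [CommRing B]
    [Algebra R B] [CommRing C] [Algebra R C] (φ : B →ₐ[R] C) (x y : B ⊗[R] M) :
    β.baseChange C (LinearMap.rTensor M φ.toLinearMap x) (LinearMap.rTensor M φ.toLinearMap y) =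
      LinearMap.rTensor N φ.toLinearMap (β.baseChange B x y) := by
  induction x using TensorProduct.induction_on with
  | zero => simp
  | add x x' hx hx' => simp only [map_add, LinearMap.add_apply, hx, hx']
  | tmul b m =>
    induction y using TensorProduct.induction_on with
    | zero => simp
    | add y y' hy hy' => simp only [map_add, hy, hy']
    | tmul c n => simp

/-- The quadratic polynomial law `x ↦ β(x, x)` given by a bilinear map `β`. -/
noncomputable def ofBilinMap (β : LinearMap.BilinMap R M N) : PolyLaw R M N where
  toFun B _ _ x := β.baseChange B x x
  isCompat _ _ _ _ _ _ φ x := rTensor_baseChange_bilinMap β φ x x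

theorem isHomogeneous_ofBilinMap (β : LinearMap.BilinMap R M N) :
    (ofBilinMap β).IsHomogeneous 2 := fun B _ _ b x => by
  simp [ofBilinMap, smul_smul, sq]

theorem ground_ofBilinMap (β : LinearMap.BilinMap R M N) (x : M) :
    (ofBilinMap β).ground x = β x x := by
  simp [ofBilinMap, ground]

theorem polar_ground_ofBilinMap (β : LinearMap.BilinMap R M N) (x y : M) :
    QuadraticMap.polar (ofBilinMap β).ground x y = β x y + β y x := by
  simp only [QuadraticMap.polar, ground_ofBilinMap, map_add, LinearMap.add_apply]
  abel

/-- On a free module there is a quadratic polynomial law with prescribed values on a basis and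
prescribed symmetric polar form. -/
theorem exists_isHomogeneous_two {ι : Type*} (b : Module.Basis ι R M) (q : ι → N) (f : ι → ι → N)
    (hf : ∀ i j, f i j = f j i) (hq : ∀ i, f i i = 2 • q i) :
    ∃ P : PolyLaw R M N, P.IsHomogeneous 2 ∧ (∀ i, P.ground (b i) = q i) ∧
      ∀ i j, QuadraticMap.polar P.ground (b i) (b j) = f i j := by
  classical
  let _ : LinearOrder ι := WellOrderingRel.isWellOrder.linearOrder
  let β : LinearMap.BilinMap R M N := b.constr R fun i => b.constr R fun j =>
    if i < j then f i j else if i = j then q i else 0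
  have hβ (i j : ι) : β (b i) (b j) = if i < j then f i j else if i = j then q i else 0 := by
    simp [β]
  refine ⟨ofBilinMap β, isHomogeneous_ofBilinMap β, fun i => ?_, fun i j => ?_⟩
  · simp [ground_ofBilinMap, hβ]
  · rw [polar_ground_ofBilinMap, hβ, hβ]
    rcases lt_trichotomy i j with h | rfl | h
    · simp [h, h.not_gt, h.ne']
    · simp [hq, two_nsmul]
    · simp [h, h.not_gt, h.ne', hf i j]

end Quadratic

section Multiplicative

variable {R S T : Type} [CommRing R] [Ring S] [Algebra R S] [CommRing T] [Algebra R T]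
  {P : PolyLaw R S T}

theorem IsMultiplicative.ground_one (hP : P.IsMultiplicative) : P.ground 1 = 1 := by
  have h := hP.1 R
  rw [Algebra.TensorProduct.one_def] at h
  simp [ground, h, Algebra.TensorProduct.one_def]

theorem IsMultiplicative.ground_mul (hP : P.IsMultiplicative) (x y : S) :
    P.ground (x * y) = P.ground x * P.ground y := by
  have h := hP.2 R (1 ⊗ₜ x) (1 ⊗ₜ y)
  rw [Algebra.TensorProduct.tmul_mul_tmul, mul_one] at h
  rw [ground, h]
  exact map_mul (Algebra.TensorProduct.lid R T) _ _

theorem IsMultiplicative.polar_ground_mul_left (hP : P.IsMultiplicative) (z x y : S) :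
    QuadraticMap.polar P.ground (z * x) (z * y) = P.ground z * QuadraticMap.polar P.ground x y := by
  simp only [QuadraticMap.polar, ← mul_add, hP.ground_mul]
  ring

theorem IsMultiplicative.polar_ground_mul_right (hP : P.IsMultiplicative) (z x y : S) :
    QuadraticMap.polar P.ground (x * z) (y * z) = QuadraticMap.polar P.ground x y * P.ground z := by
  simp only [QuadraticMap.polar, ← add_mul, hP.ground_mul]
  ring

theorem IsMultiplicative.polar_ground_one_mul_add (hP : P.IsMultiplicative)
    (hP' : P.IsHomogeneous 2) (x y : S) :
    QuadraticMap.polar P.ground 1 (x * y) + QuadraticMap.polar P.ground x y =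
      QuadraticMap.polar P.ground 1 x * QuadraticMap.polar P.ground 1 y := by
  have h := hP.ground_mul (1 + x) (1 + y)
  have hx := hP.polar_ground_mul_left x 1 y
  have hy := hP.polar_ground_mul_right y 1 x
  rw [mul_one] at hx
  rw [one_mul, QuadraticMap.polar_comm] at hy
  have hadd (u v : S) : P.ground (u + v) =
      P.ground u + P.ground v + QuadraticMap.polar P.ground u v := QuadraticMap.map_add _ u v
  have hpol (u v w : S) : QuadraticMap.polar P.ground (u + v) w =
      QuadraticMap.polar P.ground u w + QuadraticMap.polar P.ground v w :=
    QuadraticMap.polar_add_left hP'.groundQuadraticMap u v w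
  rw [show (1 + x) * (1 + y) = 1 + x + y + x * y by noncomm_ring] at h
  simp only [hadd, hpol, hP.ground_one, hP.ground_mul] at h
  rw [hx, QuadraticMap.polar_comm _ y (x * y), hy] at h
  linear_combination h

/-- A quadratic polynomial law is multiplicative if it is so, together with its polarizations, on a
spanning family. -/
theorem IsHomogeneous.isMultiplicative_of_span {ι : Type*} {v : ι → S}
    (hv : Submodule.span R (Set.range v) = ⊤) (hP : P.IsHomogeneous 2) (h1 : P.ground 1 = 1)
    (hmul : ∀ i j, P.ground (v i * v j) = P.ground (v i) * P.ground (v j))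
    (hleft : ∀ i j k, QuadraticMap.polar P.ground (v i * v j) (v i * v k) =
      P.ground (v i) * QuadraticMap.polar P.ground (v j) (v k))
    (hright : ∀ i j k, QuadraticMap.polar P.ground (v j * v i) (v k * v i) =
      QuadraticMap.polar P.ground (v j) (v k) * P.ground (v i))
    (hpolar : ∀ i j k l, QuadraticMap.polar P.ground (v i * v k) (v j * v l) +
      QuadraticMap.polar P.ground (v i * v l) (v j * v k) =
      QuadraticMap.polar P.ground (v i) (v j) * QuadraticMap.polar P.ground (v k) (v l)) :
    P.IsMultiplicative := by
  refine ⟨fun B _ _ => ?_, fun B _ _ => ?_⟩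
  · rw [Algebra.TensorProduct.one_def, toFun_one_tmul, h1, Algebra.TensorProduct.one_def]
  let Q := hP.quadraticMap B
  let w (i : ι) : B ⊗[R] S := 1 ⊗ₜ v i
  have hw : Submodule.span B (Set.range w) = ⊤ := span_one_tmul hv B
  have hww (i j : ι) : w i * w j = 1 ⊗ₜ (v i * v j) := by
    simp only [w, Algebra.TensorProduct.tmul_mul_tmul, mul_one]
  have hQ (x : S) : Q (1 ⊗ₜ x) = 1 ⊗ₜ P.ground x := P.toFun_one_tmul B x
  have hQp (x y : S) : QuadraticMap.polar Q (1 ⊗ₜ x) (1 ⊗ₜ y) =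
      1 ⊗ₜ QuadraticMap.polar P.ground x y := P.polar_toFun_one_tmul B x y
  have left (x : B ⊗[R] S) (hx : ∀ j, Q (x * w j) = Q x * Q (w j))
      (hxp : ∀ j k, QuadraticMap.polar Q (x * w j) (x * w k) =
        Q x * QuadraticMap.polar Q (w j) (w k)) (y : B ⊗[R] S) : Q (x * y) = Q x * Q y := by
    have := QuadraticMap.ext_of_span hw (Q := Q.comp (LinearMap.mulLeft B x))
      (Q' := (LinearMap.mulLeft B (Q x)).compQuadraticMap Q) (by simpa using hx) fun j k => by
        simpa [QuadraticMap.polar, mul_add, mul_sub] using hxp j k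
    exact DFunLike.congr_fun this y
  have basis_left (i : ι) (y : B ⊗[R] S) : Q (w i * y) = Q (w i) * Q y :=
    left (w i)
      (fun j => by
        simp only [hww, w, hQ, hmul, Algebra.TensorProduct.tmul_mul_tmul, mul_one])
      (fun j k => by
        simp only [hww, w, hQ, hQp, hleft, Algebra.TensorProduct.tmul_mul_tmul, mul_one]) y
  have basis_polar (i j : ι) (y : B ⊗[R] S) : QuadraticMap.polar Q (w i * y) (w j * y) =
      QuadraticMap.polar Q (w i) (w j) * Q y := by
    let L := Q.polarBilin.compl₁₂ (LinearMap.mulLeft B (w i)) (LinearMap.mulLeft B (w j))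
    have hL (x y : B ⊗[R] S) : L x y = QuadraticMap.polar Q (w i * x) (w j * y) := rfl
    have := QuadraticMap.ext_of_span hw (Q := LinearMap.BilinMap.toQuadraticMap L)
      (Q' := (LinearMap.mulLeft B (QuadraticMap.polar Q (w i) (w j))).compQuadraticMap Q)
      (fun k => ?_) (fun k l => ?_)
    · exact DFunLike.congr_fun this y
    · rw [LinearMap.BilinMap.toQuadraticMap_apply, hL, hww, hww, hQp, hright]
      simp [w, hQ, hQp]
    · rw [LinearMap.BilinMap.polar_toQuadraticMap, hL, hL]
      simp only [hww, hQp, ← TensorProduct.tmul_add, hpolar]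
      have : QuadraticMap.polar ((LinearMap.mulLeft B
          (QuadraticMap.polar Q (w i) (w j))).compQuadraticMap Q) (w k) (w l) =
          QuadraticMap.polar Q (w i) (w j) * QuadraticMap.polar Q (w k) (w l) := by
        simp [QuadraticMap.polar, mul_sub]
      rw [this]
      simp [w, hQp]
  intro x y
  have := QuadraticMap.ext_of_span hw (Q := Q.comp (LinearMap.mulRight B y))
    (Q' := (LinearMap.mulLeft B (Q y)).compQuadraticMap Q)
    (fun i => by simp [basis_left, mul_comm]) fun i j => by
      simpa [QuadraticMap.polar, add_mul, mul_sub, sub_mul, mul_comm (Q y)] using basis_polar i j y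
  exact (DFunLike.congr_fun this x).trans (mul_comm _ _)

end Multiplicative

end PolyLaw

section Group

open PolyLaw

variable {D : PolyLaw ℤ (MonoidAlgebra ℤ G) A}

theorem traceFn_eq_polar (hD : D.IsHomogeneous 2) (g : G) :
    traceFn D g = QuadraticMap.polar D.ground 1 (MonoidAlgebra.of ℤ G g) := by
  let x : Polynomial ℤ ⊗[ℤ] MonoidAlgebra ℤ G := 1 ⊗ₜ 1
  let y : Polynomial ℤ ⊗[ℤ] MonoidAlgebra ℤ G := 1 ⊗ₜ MonoidAlgebra.of ℤ G g
  have hX : (Polynomial.X : Polynomial ℤ) ⊗ₜ[ℤ] (1 : MonoidAlgebra ℤ G)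
      = (Polynomial.X : Polynomial ℤ) • x := by simp [x, TensorProduct.smul_tmul']
  have h : D.toFun (Polynomial ℤ) ((Polynomial.X : Polynomial ℤ) • x - y) =
      (Polynomial.X * Polynomial.X : Polynomial ℤ) • D.toFun _ x + D.toFun _ y
        - (Polynomial.X : Polynomial ℤ) • QuadraticMap.polar (D.toFun _) x y := by
    have := QuadraticMap.map_add (hD.quadraticMap (Polynomial ℤ))
      ((Polynomial.X : Polynomial ℤ) • x) (-y)
    rw [QuadraticMap.polar_neg_right, QuadraticMap.polar_smul_left, QuadraticMap.map_neg,
      QuadraticMap.map_smul, ← sub_eq_add_neg, ← sub_eq_add_neg] at this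
    exact this
  rw [traceFn, hX, h]
  simp only [x, y, toFun_one_tmul, polar_toFun_one_tmul, TensorProduct.smul_tmul', map_add, map_sub,
    LinearMap.rTensor_tmul]
  simp [Polynomial.coeff_one, ← sq, Polynomial.coeff_X_pow]

theorem polar_ground_of (hD : D.IsHomogeneous 2) (hD' : D.IsMultiplicative) (g h : G) :
    QuadraticMap.polar D.ground (MonoidAlgebra.of ℤ G g) (MonoidAlgebra.of ℤ G h) =
      detFn D g * traceFn D (g⁻¹ * h) := by
  rw [traceFn_eq_polar hD, detFn, ← hD'.polar_ground_mul_left, mul_one, ← map_mul,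
    mul_inv_cancel_left]

theorem pairCond_traceFn_detFn (hD : D.IsHomogeneous 2) (hD' : D.IsMultiplicative) :
    PairCond (traceFn D) (detFn D) := by
  have h1 : detFn D 1 = 1 := by rw [detFn, map_one, hD'.ground_one]
  have hmul (g h : G) : detFn D (g * h) = detFn D g * detFn D h := by
    rw [detFn, map_mul, hD'.ground_mul, detFn, detFn]
  have hunit (g : G) : IsUnit (detFn D g) :=
    .of_mul_eq_one (detFn D g⁻¹) (by rw [← hmul, mul_inv_cancel, h1])
  refine ⟨hunit, h1, hmul, ?_, fun g h => (hunit g).mul_left_cancel ?_, fun g h => ?_⟩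
  · rw [traceFn_eq_polar hD, map_one]
    exact (QuadraticMap.polar_self hD.groundQuadraticMap 1).trans (by simp [hD'.ground_one])
  · rw [traceFn_eq_polar hD, traceFn_eq_polar hD, mul_comm, detFn,
      ← hD'.polar_ground_mul_left, ← hD'.polar_ground_mul_right]
    simp only [one_mul, mul_one, map_mul, mul_assoc]
  · rw [← polar_ground_of hD hD']
    simp only [traceFn_eq_polar hD]
    rw [← hD'.polar_ground_one_mul_add hD, map_mul]
    ring

theorem span_range_of : Submodule.span ℤ (Set.range (MonoidAlgebra.of ℤ G)) = ⊤ := by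
  have h : ⇑(MonoidAlgebra.of ℤ G) = MonoidAlgebra.basis G ℤ := funext fun g => by simp
  rw [h]
  exact (MonoidAlgebra.basis G ℤ).span_eq

theorem exists_of_pairCond {t d : G → A} (h : PairCond t d) :
    ∃ D : PolyLaw ℤ (MonoidAlgebra ℤ G) A,
      (D.IsHomogeneous 2 ∧ D.IsMultiplicative) ∧ traceFn D = t ∧ detFn D = d := by
  obtain ⟨-, h1, hmul, ht, hcomm, hrel⟩ := h
  obtain ⟨D, hD, hground, hpolar⟩ := exists_isHomogeneous_two (MonoidAlgebra.basis G ℤ) d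
    (fun g h => d g * t (g⁻¹ * h)) (fun g h => by linear_combination hrel g h - hrel h g - hcomm g h)
    (fun g => by rw [inv_mul_cancel, ht, two_nsmul, mul_two])
  have hb (g : G) : MonoidAlgebra.basis G ℤ g = MonoidAlgebra.of ℤ G g := by simp
  simp only [hb] at hground hpolar
  have hconj (g h : G) : t (g⁻¹ * h * g) = t h := by
    rw [hcomm, mul_inv_cancel_left]
  refine ⟨D, ⟨hD, hD.isMultiplicative_of_span span_range_of ?_ ?_ ?_ ?_ ?_⟩, ?_, funext hground⟩
  · rw [← map_one (MonoidAlgebra.of ℤ G), hground, h1]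
  · intro g h
    rw [← map_mul, hground, hground, hground, hmul]
  · intro g h k
    rw [← map_mul, ← map_mul, hground, hpolar, hpolar, hmul, mul_assoc]
    congr 3
    group
  · intro g h k
    rw [← map_mul, ← map_mul, hground, hpolar, hpolar, hmul, ← hconj g (h⁻¹ * k)]
    rw [show (h * g)⁻¹ * (k * g) = g⁻¹ * (h⁻¹ * k) * g by group]
    ring
  · intro g g' h h'
    simp only [← map_mul, hpolar, hmul]
    have e1 : t ((g * h)⁻¹ * (g' * h')) = t (h' * h⁻¹ * (g⁻¹ * g')) := by
      rw [hcomm (h' * h⁻¹), ← hconj h (g⁻¹ * g' * (h' * h⁻¹))]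
      congr 1
      group
    have e2 : t ((g * h')⁻¹ * (g' * h)) = t ((h' * h⁻¹)⁻¹ * (g⁻¹ * g')) := by
      rw [← hconj h ((h' * h⁻¹)⁻¹ * (g⁻¹ * g'))]
      congr 1
      group
    have e3 : t (h⁻¹ * h') = t (h' * h⁻¹) := hcomm _ _
    have e4 : d h' = d (h' * h⁻¹) * d h := by rw [← hmul, inv_mul_cancel_right]
    rw [e1, e2, e3, e4]
    linear_combination d g * d h * hrel (h' * h⁻¹) (g⁻¹ * g')
  · funext g
    rw [traceFn_eq_polar hD, ← map_one (MonoidAlgebra.of ℤ G), hpolar, h1, inv_one, one_mul,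
      one_mul]

end Group

/-- The map `D ↦ (T, D|_G)` is a bijection between the set of `2`-dimensional
`A`-valued determinants on `G` and the set of pairs `(T, D)` of functions `G → A` such that
`D : G → Aˣ` is a group homomorphism, `T(1) = 2`, `T(gh) = T(hg)` and
`D(g)T(g⁻¹h) − T(g)T(h) + T(gh) = 0`. -/
theorem det_dim_two_equiv_pairs (G A : Type) [Group G] [CommRing A] :
    ∃ F : {D : PolyLaw ℤ (MonoidAlgebra ℤ G) A // D.IsHomogeneous 2 ∧ D.IsMultiplicative} →
          {p : (G → A) × (G → A) // PairCond p.1 p.2},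
      (∀ D, ((F D : (G → A) × (G → A)).1 = traceFn D.1 ∧
             (F D : (G → A) × (G → A)).2 = detFn D.1)) ∧
      Function.Bijective F := by
  refine ⟨fun D => ⟨(traceFn D.1, detFn D.1), pairCond_traceFn_detFn D.2.1 D.2.2⟩,
    fun D => ⟨rfl, rfl⟩, ?_, ?_⟩
  · rintro ⟨D, hD, hm⟩ ⟨D', hD', hm'⟩ h
    obtain ⟨ht, hd⟩ := Prod.ext_iff.1 (Subtype.ext_iff.1 h)
    dsimp only at ht hd
    refine Subtype.ext (hD.ext_of_span span_range_of hD' (congrFun hd) fun g h => ?_)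
    rw [polar_ground_of hD hm, polar_ground_of hD' hm', ht, hd]
  · rintro ⟨⟨t, d⟩, h⟩
    obtain ⟨D, hD, ht, hd⟩ := exists_of_pairCond h
    exact ⟨⟨D, hD⟩, Subtype.ext (Prod.ext ht hd)⟩
end

section
/- Let A be a commutative ring whose only idempotents are 0 and 1, R an A-algebra, D : R → A an A-valued determinant of dimension d, and e ∈ R an idempotent. Then: (1) the A-polynomial law D_e : eRe → A, x ↦ D(x + 1 − e) (defined over any base extension), is an A-valued determinant on the A-algebra eRe (with unit e) of some dimension r(e) ≤ d; and (2) r(e) + r(1−e) = d, and the restriction of D to the A-subalgebra eRe ⊕ (1−e)R(1−e) of R is the product determinant D_e D_{1−e}. -/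
open TensorProduct

section Corner

variable {R : Type} [Ring R]

/-- The corner `eRe` of a ring `R` at an element `e` : the elements `x` with `e x e = x`. -/
def Corner (e : R) : Type := {x : R // e * x * e = x}

namespace Corner

variable (e : R)

instance : Zero (Corner e) := ⟨⟨0, by simp⟩⟩
instance : Add (Corner e) :=
  ⟨fun x y => ⟨x.1 + y.1, by rw [mul_add, add_mul, x.2, y.2]⟩⟩
instance : Neg (Corner e) := ⟨fun x => ⟨-x.1, by rw [mul_neg, neg_mul, x.2]⟩⟩
instance : Sub (Corner e) :=
  ⟨fun x y => ⟨x.1 - y.1, by rw [mul_sub, sub_mul, x.2, y.2]⟩⟩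
instance : SMul ℕ (Corner e) :=
  ⟨fun n x => ⟨n • x.1, by rw [mul_smul_comm, smul_mul_assoc, x.2]⟩⟩
instance : SMul ℤ (Corner e) :=
  ⟨fun n x => ⟨n • x.1, by rw [mul_smul_comm, smul_mul_assoc, x.2]⟩⟩

instance : AddCommGroup (Corner e) :=
  Function.Injective.addCommGroup (fun x : Corner e => x.1) Subtype.val_injective
    rfl (fun _ _ => rfl) (fun _ => rfl) (fun _ _ => rfl) (fun _ _ => rfl) (fun _ _ => rfl)

theorem idem_mul_left {e x : R} (hee : e * e = e) (hx : e * x * e = x) : e * x = x := by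
  conv_lhs => rw [← hx]
  rw [show e * (e * x * e) = e * e * x * e by noncomm_ring, hee, hx]

theorem idem_mul_right {e x : R} (hee : e * e = e) (hx : e * x * e = x) : x * e = x := by
  conv_lhs => rw [← hx]
  rw [show e * x * e * e = e * x * (e * e) by noncomm_ring, hee, hx]

variable [hf : Fact (IsIdempotentElem e)]

instance : One (Corner e) := ⟨⟨e, by rw [hf.out.eq, hf.out.eq]⟩⟩
instance : Mul (Corner e) :=
  ⟨fun x y => ⟨x.1 * y.1, by
    rw [show e * (x.1 * y.1) * e = (e * x.1) * (y.1 * e) by noncomm_ring,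
      idem_mul_left hf.out.eq x.2, idem_mul_right hf.out.eq y.2]⟩⟩

instance : Ring (Corner e) :=
  { (inferInstance : AddCommGroup (Corner e)) with
    mul := (· * ·)
    one := 1
    mul_assoc := fun x y z => Subtype.ext (mul_assoc x.1 y.1 z.1)
    one_mul := fun x => Subtype.ext (idem_mul_left hf.out.eq x.2)
    mul_one := fun x => Subtype.ext (idem_mul_right hf.out.eq x.2)
    left_distrib := fun x y z => Subtype.ext (mul_add x.1 y.1 z.1)
    right_distrib := fun x y z => Subtype.ext (add_mul x.1 y.1 z.1)
    zero_mul := fun x => Subtype.ext (zero_mul x.1)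
    mul_zero := fun x => Subtype.ext (mul_zero x.1) }

end Corner

variable {A : Type} [CommRing A] [Algebra A R]

instance (e : R) : SMul A (Corner e) :=
  ⟨fun a x => ⟨a • x.1, by rw [mul_smul_comm, smul_mul_assoc, x.2]⟩⟩

instance (e : R) : Module A (Corner e) :=
  Function.Injective.module A
    ({ toFun := fun x : Corner e => x.1, map_zero' := rfl, map_add' := fun _ _ => rfl } :
      Corner e →+ R)
    Subtype.val_injective (fun _ _ => rfl)

instance (e : R) [Fact (IsIdempotentElem e)] : Algebra A (Corner e) :=
  Algebra.ofModule
    (fun a x y => Subtype.ext (smul_mul_assoc a x.1 y.1))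
    (fun a x y => Subtype.ext (mul_smul_comm a x.1 y.1))

instance (e : R) [Fact (IsIdempotentElem e)] : Fact (IsIdempotentElem (1 - e)) :=
  ⟨(Fact.out (p := IsIdempotentElem e)).one_sub⟩

/-- The inclusion `eRe → R` as an `A`-linear map. -/
def cornerIncl (A : Type) [CommRing A] [Algebra A R] (e : R) : Corner e →ₗ[A] R where
  toFun x := x.1
  map_add' _ _ := rfl
  map_smul' _ _ := rfl

end Corner

open TensorProduct

/-- A polynomial over a connected ring which is multiplicative as a function over every base
change is a monomial `X ^ r`. -/
theorem Polynomial.exists_eq_X_pow_of_aeval_mul {A : Type} [CommRing A]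
    (hconn : ∀ a : A, IsIdempotentElem a → a = 0 ∨ a = 1) (p : Polynomial A)
    (hone : p.eval 1 = 1)
    (hmul : ∀ (B : Type) [CommRing B] [Algebra A B] (b c : B),
      Polynomial.aeval (b * c) p = Polynomial.aeval b p * Polynomial.aeval c p) :
    ∃ r : ℕ, p = Polynomial.X ^ r := by
  open Polynomial in
  have key : ∀ n, p * C (p.coeff n) = C (p.coeff n) * X ^ n := by
    intro n
    have h := congrArg (fun q => q.coeff n) (hmul A[X][X] (C X) X)
    have h1 : aeval (C X : A[X][X]) p = C p := by
      have := aeval_algHom_apply (CAlgHom : A[X] →ₐ[A] A[X][X]) X p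
      simpa using this
    have h2 : aeval (X : A[X][X]) p = p.map C := by
      rw [aeval_def, map, ← algebraMap_eq, eval₂_eq_sum, eval₂_eq_sum]
      rfl
    have h3 : (aeval (C X * X : A[X][X]) p).coeff n = C (p.coeff n) * X ^ n := by
      rw [aeval_eq_sum_range, finsetSum_coeff]
      simp only [mul_pow, coeff_smul, ← C_pow, coeff_C_mul, coeff_X_pow, mul_ite, mul_one,
        mul_zero, smul_ite, smul_zero]
      rw [Finset.sum_ite_eq]
      split_ifs with hn
      · rw [smul_eq_C_mul]
      · rw [coeff_eq_zero_of_natDegree_lt (by simpa [Nat.lt_succ_iff] using hn)]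
        simp
    simp only [h1, h2, coeff_C_mul, coeff_map] at h
    rw [← h, h3]
  have idem : ∀ n, IsIdempotentElem (p.coeff n) := by
    intro n
    have h := congrArg (fun q => Polynomial.coeff q n) (key n)
    simpa [IsIdempotentElem] using h
  by_cases hex : ∃ n, p.coeff n = 1
  · obtain ⟨n, hn⟩ := hex
    exact ⟨n, by simpa [hn] using key n⟩
  · have hp : p = 0 := by
      ext n
      simpa using (hconn _ (idem n)).resolve_right (fun h => hex ⟨n, h⟩)
    have h01 : (0 : A) = 1 := by simpa [hp] using hone
    have := subsingleton_of_zero_eq_one h01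
    exact ⟨0, Subsingleton.elim _ _⟩

section CornerBaseChange

variable {A R : Type} [CommRing A] [Ring R] [Algebra A R] {e : R}
variable {B : Type} [CommRing B] [Algebra A B]

theorem lTensor_cornerIncl_smul (b : B) (x : B ⊗[A] Corner e) :
    LinearMap.lTensor B (cornerIncl A e) (b • x)
      = b • LinearMap.lTensor B (cornerIncl A e) x := by
  induction x with
  | zero => simp
  | tmul c x => simp [TensorProduct.smul_tmul']
  | add x y hx hy => simp only [smul_add, map_add, hx, hy]

theorem rTensor_lTensor_cornerIncl {C : Type} [CommRing C] [Algebra A C] (φ : B →ₐ[A] C)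
    (x : B ⊗[A] Corner e) :
    LinearMap.lTensor C (cornerIncl A e) (LinearMap.rTensor (Corner e) φ.toLinearMap x)
      = LinearMap.rTensor R φ.toLinearMap (LinearMap.lTensor B (cornerIncl A e) x) := by
  rw [← LinearMap.comp_apply, ← LinearMap.comp_apply, LinearMap.lTensor_comp_rTensor,
    LinearMap.rTensor_comp_lTensor]

theorem rTensor_one_tmul {C : Type} [CommRing C] [Algebra A C] (φ : B →ₐ[A] C) (a : R) :
    LinearMap.rTensor R φ.toLinearMap ((1 : B) ⊗ₜ[A] a) = (1 : C) ⊗ₜ[A] a := by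
  simp

theorem rTensor_one {C : Type} [CommRing C] [Algebra A C] (φ : B →ₐ[A] C) :
    LinearMap.rTensor R φ.toLinearMap (1 : B ⊗[A] R) = 1 :=
  rTensor_one_tmul φ 1

variable [hf : Fact (IsIdempotentElem e)]

theorem lTensor_cornerIncl_one :
    LinearMap.lTensor B (cornerIncl A e) (1 : B ⊗[A] Corner e) = (1 : B) ⊗ₜ[A] e :=
  rfl

theorem lTensor_cornerIncl_mul (x y : B ⊗[A] Corner e) :
    LinearMap.lTensor B (cornerIncl A e) (x * y)
      = LinearMap.lTensor B (cornerIncl A e) x * LinearMap.lTensor B (cornerIncl A e) y := by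
  induction x with
  | zero => simp
  | add x x' hx hx' => simp only [add_mul, map_add, hx, hx']
  | tmul b x =>
    induction y with
    | zero => simp
    | add y y' hy hy' => simp only [mul_add, map_add, hy, hy']
    | tmul c y =>
      rw [Algebra.TensorProduct.tmul_mul_tmul, LinearMap.lTensor_tmul, LinearMap.lTensor_tmul,
        LinearMap.lTensor_tmul, Algebra.TensorProduct.tmul_mul_tmul]
      rfl

theorem one_tmul_mul_lTensor_cornerIncl (x : B ⊗[A] Corner e) :
    ((1 : B) ⊗ₜ[A] e) * LinearMap.lTensor B (cornerIncl A e) x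
      = LinearMap.lTensor B (cornerIncl A e) x := by
  rw [← lTensor_cornerIncl_one, ← lTensor_cornerIncl_mul, one_mul]

theorem lTensor_cornerIncl_mul_one_tmul (x : B ⊗[A] Corner e) :
    LinearMap.lTensor B (cornerIncl A e) x * ((1 : B) ⊗ₜ[A] e)
      = LinearMap.lTensor B (cornerIncl A e) x := by
  rw [← lTensor_cornerIncl_one, ← lTensor_cornerIncl_mul, mul_one]

theorem isIdempotentElem_one_tmul (B : Type) [CommRing B] [Algebra A B] (e : R)
    [hf : Fact (IsIdempotentElem e)] : IsIdempotentElem ((1 : B) ⊗ₜ[A] e) := by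
  rw [IsIdempotentElem, Algebra.TensorProduct.tmul_mul_tmul, one_mul, hf.out.eq]

end CornerBaseChange

namespace PolyLaw

variable {A R : Type} [CommRing A] [Ring R] [Algebra A R]

/-- The polynomial law `x ↦ P (x + 1 - e)` on the corner `eRe`. -/
noncomputable def corner (P : PolyLaw A R A) (e : R) : PolyLaw A (Corner e) A where
  toFun B _ _ x := P.toFun B (LinearMap.lTensor B (cornerIncl A e) x + 1 - (1 : B) ⊗ₜ[A] e)
  isCompat B _ _ C _ _ φ x := by
    rw [← P.isCompat, map_sub, map_add, rTensor_lTensor_cornerIncl, rTensor_one,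
      rTensor_one_tmul]

theorem IsMultiplicative.corner {P : PolyLaw A R A} (hP : P.IsMultiplicative) (e : R)
    [Fact (IsIdempotentElem e)] : (P.corner e).IsMultiplicative := by
  refine ⟨fun B _ _ => ?_, fun B _ _ x y => ?_⟩
  · simp only [PolyLaw.corner]
    rw [lTensor_cornerIncl_one, add_sub_cancel_left, hP.1]
  · simp only [PolyLaw.corner]
    rw [← hP.2, lTensor_cornerIncl_mul]
    congr 1
    simp only [mul_add, mul_sub, add_mul, sub_mul, mul_one, one_mul,
      one_tmul_mul_lTensor_cornerIncl, lTensor_cornerIncl_mul_one_tmul,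
      (isIdempotentElem_one_tmul B e).eq]
    abel

theorem IsMultiplicative.exists_isHomogeneous
    (hconn : ∀ a : A, IsIdempotentElem a → a = 0 ∨ a = 1) {S : Type} [Ring S] [Algebra A S]
    {P : PolyLaw A S A} (hP : P.IsMultiplicative) : ∃ r, P.IsHomogeneous r := by
  open Polynomial in
  set p : A[X] := Algebra.TensorProduct.rid A A[X] A[X] (P.toFun A[X] ((X : A[X]) • 1)) with hp
  have hval : ∀ (B : Type) [CommRing B] [Algebra A B] (b : B),
      Algebra.TensorProduct.rid A B B (P.toFun B (b • 1)) = aeval b p := by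
    intro B _ _ b
    have h1 : b • (1 : B ⊗[A] S)
        = LinearMap.rTensor S (aeval (R := A) b).toLinearMap ((X : A[X]) • 1) := by
      simp [Algebra.TensorProduct.one_def, TensorProduct.smul_tmul']
    have h2 : ∀ z : A[X] ⊗[A] A, Algebra.TensorProduct.rid A B B
        (LinearMap.rTensor A (aeval (R := A) b).toLinearMap z)
          = aeval b (Algebra.TensorProduct.rid A A[X] A[X] z) := by
      intro z
      induction z with
      | zero => simp
      | tmul q a => simp
      | add x y hx hy => simp only [map_add, hx, hy]
    rw [h1, P.isCompat, h2]
  obtain ⟨r, hr⟩ := Polynomial.exists_eq_X_pow_of_aeval_mul hconn p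
    (by rw [← coe_aeval_eq_eval, ← hval, one_smul, hP.1, map_one])
    (by
      intro B _ _ b c
      rw [← hval, ← hval, ← hval, ← map_mul, ← hP.2, smul_mul_smul_comm, one_mul])
  refine ⟨r, fun B _ _ b x => ?_⟩
  have hb : P.toFun B (b • 1) = b ^ r • 1 := by
    apply (Algebra.TensorProduct.rid A B B).injective
    rw [hval, hr, map_smul, map_one]
    simp
  rw [← one_mul x, ← smul_mul_assoc, hP.2, hb, smul_mul_assoc, one_mul, one_mul]

theorem IsMultiplicative.toFun_add_corner {P : PolyLaw A R A} (hP : P.IsMultiplicative) (e : R)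
    [Fact (IsIdempotentElem e)] (B : Type) [CommRing B] [Algebra A B]
    (x : B ⊗[A] Corner e) (y : B ⊗[A] Corner (1 - e)) :
    P.toFun B (LinearMap.lTensor B (cornerIncl A e) x
        + LinearMap.lTensor B (cornerIncl A (1 - e)) y)
      = (P.corner e).toFun B x * (P.corner (1 - e)).toFun B y := by
  simp only [PolyLaw.corner]
  rw [← hP.2]
  congr 1
  have hF : (1 : B) ⊗ₜ[A] (1 - e) = 1 - (1 : B) ⊗ₜ[A] e := by
    rw [TensorProduct.tmul_sub, Algebra.TensorProduct.one_def]
  have hx := lTensor_cornerIncl_mul_one_tmul (A := A) (B := B) x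
  have hy := one_tmul_mul_lTensor_cornerIncl (A := A) (B := B) y
  have hE := (isIdempotentElem_one_tmul (A := A) B e).eq
  rw [hF] at hy ⊢
  generalize LinearMap.lTensor B (cornerIncl A e) x = u at *
  generalize LinearMap.lTensor B (cornerIncl A (1 - e)) y = v at *
  generalize (1 : B) ⊗ₜ[A] e = E at *
  have hEv : E * v = 0 := by simpa [sub_mul] using hy
  have huv : u * v = 0 := by rw [← hx, mul_assoc, hEv, mul_zero]
  simp only [mul_add, mul_sub, add_mul, sub_mul, mul_one, one_mul, hx, hE,
    hEv, huv]
  abel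

theorem IsHomogeneous.of_subsingleton [Subsingleton A] {M : Type} [AddCommGroup M] [Module A M]
    {N : Type} [AddCommGroup N] [Module A N] (P : PolyLaw A M N) (d : ℕ) :
    P.IsHomogeneous d := by
  intro B _ _ b x
  have := Module.subsingleton A (B ⊗[A] N)
  exact Subsingleton.elim _ _

/-- The degrees of the restrictions of a determinant to complementary corners add up. -/
theorem IsHomogeneous.corner_add_eq [Nontrivial A] {P : PolyLaw A R A} {d r r' : ℕ}
    (hd : P.IsHomogeneous d) (hP : P.IsMultiplicative) (e : R) [Fact (IsIdempotentElem e)]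
    (hr : (P.corner e).IsHomogeneous r) (hr' : (P.corner (1 - e)).IsHomogeneous r') :
    r + r' = d := by
  open Polynomial in
  have h := hP.toFun_add_corner e A[X] ((X : A[X]) • 1) ((X : A[X]) • 1)
  rw [hr, hr', (hP.corner e).1, (hP.corner (1 - e)).1, lTensor_cornerIncl_smul,
    lTensor_cornerIncl_smul, lTensor_cornerIncl_one, lTensor_cornerIncl_one, ← smul_add,
    ← TensorProduct.tmul_add, add_sub_cancel, ← Algebra.TensorProduct.one_def, hd, hP.1,
    smul_mul_smul_comm, one_mul, ← pow_add] at h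
  have h' := congrArg (Algebra.TensorProduct.rid A A[X] A[X]) h
  rw [map_smul, map_smul, map_one, smul_eq_mul, smul_eq_mul, mul_one, mul_one] at h'
  simpa using (congrArg natDegree h').symm

end PolyLaw

/-- Let `A` be a commutative ring whose only idempotents are `0` and `1`,
`D : R → A` a determinant of dimension `d` and `e ∈ R` an idempotent.  Then
`D_e : eRe → A, x ↦ D(x + 1 − e)` is a determinant on `eRe` of some dimension `r(e) ≤ d`;
moreover `r(e) + r(1−e) = d` and the restriction of `D` to `eRe ⊕ (1−e)R(1−e)` is the
product determinant `D_e D_{1−e}`. -/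
theorem det_restrict_corner (A R : Type) [CommRing A] [Ring R] [Algebra A R]
    (hconn : ∀ a : A, IsIdempotentElem a → a = 0 ∨ a = 1)
    (d : ℕ) (D : PolyLaw A R A) (hhom : D.IsHomogeneous d) (hmul : D.IsMultiplicative)
    (e : R) [hf : Fact (IsIdempotentElem e)] :
    ∃ (De : PolyLaw A (Corner e) A) (De' : PolyLaw A (Corner (1 - e)) A) (re re' : ℕ),
      (∀ (B : Type) [CommRing B] [Algebra A B] (x : B ⊗[A] Corner e),
        De.toFun B x
          = D.toFun B (LinearMap.lTensor B (cornerIncl A e) x + 1 - (1 : B) ⊗ₜ[A] e)) ∧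
      (∀ (B : Type) [CommRing B] [Algebra A B] (x : B ⊗[A] Corner (1 - e)),
        De'.toFun B x
          = D.toFun B (LinearMap.lTensor B (cornerIncl A (1 - e)) x + 1 - (1 : B) ⊗ₜ[A] (1 - e))) ∧
      De.IsMultiplicative ∧ De.IsHomogeneous re ∧ re ≤ d ∧
      De'.IsMultiplicative ∧ De'.IsHomogeneous re' ∧ re' ≤ d ∧
      re + re' = d ∧
      ∀ (B : Type) [CommRing B] [Algebra A B]
          (x : B ⊗[A] Corner e) (y : B ⊗[A] Corner (1 - e)),
        D.toFun B (LinearMap.lTensor B (cornerIncl A e) x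
            + LinearMap.lTensor B (cornerIncl A (1 - e)) y)
          = De.toFun B x * De'.toFun B y := by
  obtain ⟨r, r', hr, hr', hadd⟩ : ∃ r r', (D.corner e).IsHomogeneous r ∧
      (D.corner (1 - e)).IsHomogeneous r' ∧ r + r' = d := by
    rcases subsingleton_or_nontrivial A with _ | _
    · exact ⟨0, d, .of_subsingleton _ _, .of_subsingleton _ _, zero_add d⟩
    · obtain ⟨r, hr⟩ := (hmul.corner e).exists_isHomogeneous hconn
      obtain ⟨r', hr'⟩ := (hmul.corner (1 - e)).exists_isHomogeneous hconn
      exact ⟨r, r', hr, hr', hhom.corner_add_eq hmul e hr hr'⟩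
  exact ⟨D.corner e, D.corner (1 - e), r, r', fun _ _ _ _ => rfl, fun _ _ _ _ => rfl,
    hmul.corner e, hr, by omega, hmul.corner (1 - e), hr', by omega, hadd,
    hmul.toFun_add_corner e⟩
end
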